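/- Let p > 0 and α ≤ p. Then there exist constants C₁', C₂' > 0, depending only on p and α, such that C₁' t^{p+1} (log(e+t))^{−α} ≤ A(t) ≤ C₂' t^{p+1} (log(e+t))^{−α} for all t ≥ 0; moreover there exist constants d₁, d₂ > 0 such that d₁ · t·a(t) ≤ A(t) ≤ d₂ · t·a(t) for all t ≥ 0. -/

import Mathlib

open Real Set

/-- a(t) = t^p / (log(e+t))^α. -/
noncomputable def a (p α t : ℝ) : ℝ := t ^ p / Real.log (Real.exp 1 + t) ^ α

/-- A(t) = ∫₀ᵗ a(s) ds. -/
noncomputable def A (p α t : ℝ) : ℝ := ∫ s in (0:ℝ)..t, a p α s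

theorem one_le_log_exp_one_add {t : ℝ} (ht : 0 ≤ t) : 1 ≤ Real.log (Real.exp 1 + t) := by
  rw [Real.le_log_iff_exp_le (by positivity)]
  linarith

theorem log_exp_one_add_mono {s t : ℝ} (hs : 0 ≤ s) (hst : s ≤ t) :
    Real.log (Real.exp 1 + s) ≤ Real.log (Real.exp 1 + t) :=
  Real.log_le_log (by positivity) (by linarith)

/-- The function `t / log (e + t)` is nondecreasing on `[0, ∞)`. -/
theorem mul_log_exp_one_add_le {s t : ℝ} (hs : 0 ≤ s) (hst : s ≤ t) :
    s * Real.log (Real.exp 1 + t) ≤ t * Real.log (Real.exp 1 + s) := by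
  have he : 0 < Real.exp 1 + s := by positivity
  have het : 0 < Real.exp 1 + t := by linarith
  have hlog : Real.log (Real.exp 1 + t) - Real.log (Real.exp 1 + s) ≤
      (t - s) / (Real.exp 1 + s) := by
    rw [← Real.log_div het.ne' he.ne']
    refine (Real.log_le_sub_one_of_pos (div_pos het he)).trans_eq ?_
    field_simp
    ring
  have hfrac : s * ((t - s) / (Real.exp 1 + s)) ≤ t - s := by
    rw [mul_div_assoc', div_le_iff₀ he]
    nlinarith [mul_nonneg (sub_nonneg.2 hst) (Real.exp_pos 1).le]
  nlinarith [mul_le_mul_of_nonneg_left hlog hs,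
    mul_le_mul_of_nonneg_left (one_le_log_exp_one_add hs) (sub_nonneg.2 hst)]

theorem a_nonneg {p α t : ℝ} (ht : 0 ≤ t) : 0 ≤ a p α t :=
  div_nonneg (Real.rpow_nonneg ht p)
    (Real.rpow_nonneg (zero_le_one.trans (one_le_log_exp_one_add ht)) α)

theorem a_monotoneOn {p α : ℝ} (hp : 0 < p) (hα : α ≤ p) : MonotoneOn (a p α) (Ici 0) := by
  intro s hs t ht hst
  rw [mem_Ici] at hs ht
  have hLs := one_le_log_exp_one_add hs
  have hLt := one_le_log_exp_one_add ht
  have hL := log_exp_one_add_mono hs hst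
  have hmul := mul_log_exp_one_add_le hs hst
  unfold a
  set x := Real.log (Real.exp 1 + s)
  set y := Real.log (Real.exp 1 + t)
  have hx : 0 < x := by linarith
  have hy : 0 < y := by linarith
  rw [div_le_div_iff₀ (Real.rpow_pos_of_pos hx α) (Real.rpow_pos_of_pos hy α)]
  rcases le_total α 0 with h | h
  · exact mul_le_mul (Real.rpow_le_rpow hs hst hp.le)
      (Real.rpow_le_rpow_of_nonpos hx hL h) (Real.rpow_nonneg hy.le α) (Real.rpow_nonneg ht p)
  · have split : ∀ r z : ℝ, 0 ≤ r → 0 < z → r ^ p * z ^ α = r ^ (p - α) * (r * z) ^ α := by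
      intro r z hr hz
      rw [Real.mul_rpow hr hz.le, ← mul_assoc,
        ← Real.rpow_add_of_nonneg hr (sub_nonneg.2 hα) h, sub_add_cancel]
    rw [split s y hs hy, split t x ht hx]
    exact mul_le_mul (Real.rpow_le_rpow hs hst (sub_nonneg.2 hα))
      (Real.rpow_le_rpow (by positivity) hmul h) (by positivity) (by positivity)

theorem a_intervalIntegrable {p α s t : ℝ} (hp : 0 < p) (hα : α ≤ p) (hs : 0 ≤ s) (ht : 0 ≤ t) :
    IntervalIntegrable (a p α) MeasureTheory.volume s t :=
  ((a_monotoneOn hp hα).mono fun _ hx => (le_min hs ht).trans hx.1).intervalIntegrable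

theorem A_le_mul_a {p α t : ℝ} (hp : 0 < p) (hα : α ≤ p) (ht : 0 ≤ t) :
    A p α t ≤ t * a p α t := by
  have h := intervalIntegral.integral_mono_on ht (a_intervalIntegrable hp hα le_rfl ht)
    (intervalIntegrable_const (c := a p α t))
    fun s hs => a_monotoneOn hp hα hs.1 ht hs.2
  simpa [A] using h

theorem half_mul_a_half_le_A {p α t : ℝ} (hp : 0 < p) (hα : α ≤ p) (ht : 0 ≤ t) :
    t / 2 * a p α (t / 2) ≤ A p α t := by
  have ht2 : 0 ≤ t / 2 := by linarith
  have hnonneg : 0 ≤ ∫ s in (0:ℝ)..(t / 2), a p α s :=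
    intervalIntegral.integral_nonneg ht2 fun s hs => a_nonneg hs.1
  have hright := intervalIntegral.integral_mono_on (by linarith : t / 2 ≤ t)
    (intervalIntegrable_const (c := a p α (t / 2))) (a_intervalIntegrable hp hα ht2 ht)
    fun s hs => a_monotoneOn hp hα ht2 (ht2.trans hs.1) hs.1
  rw [intervalIntegral.integral_const, smul_eq_mul, sub_half] at hright
  have hsplit := intervalIntegral.integral_add_adjacent_intervals
    (a_intervalIntegrable hp hα le_rfl ht2) (a_intervalIntegrable hp hα ht2 ht)
  unfold A
  linarith

theorem mul_a_le_a_half {p α t : ℝ} (ht : 0 ≤ t) :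
    2 ^ (-p - |α|) * a p α t ≤ a p α (t / 2) := by
  have ht2 : 0 ≤ t / 2 := by linarith
  have hLs := one_le_log_exp_one_add ht2
  have hL := log_exp_one_add_mono ht2 (half_le_self ht)
  have hmul : Real.log (Real.exp 1 + t) ≤ 2 * Real.log (Real.exp 1 + t / 2) := by
    rcases ht.eq_or_lt with rfl | hpos
    · norm_num
    · have h := mul_log_exp_one_add_le ht2 (half_le_self ht)
      refine le_of_mul_le_mul_left ?_ (half_pos hpos)
      linarith
  unfold a
  set x := Real.log (Real.exp 1 + t / 2)
  set y := Real.log (Real.exp 1 + t)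
  have hx : 0 < x := by linarith
  have hy : 0 < y := by linarith
  have key : x ^ α ≤ 2 ^ |α| * y ^ α := by
    rcases le_total 0 α with h | h
    · exact (Real.rpow_le_rpow hx.le hL h).trans (le_mul_of_one_le_left (by positivity)
        (Real.one_le_rpow one_le_two (abs_nonneg α)))
    · have h2 := Real.rpow_le_rpow_of_nonpos hy hmul h
      rw [Real.mul_rpow zero_le_two hx.le] at h2
      have h3 := mul_le_mul_of_nonneg_left h2 (by positivity : (0:ℝ) ≤ 2 ^ |α|)
      rwa [← mul_assoc, ← Real.rpow_add two_pos, abs_of_nonpos h, neg_add_cancel,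
        Real.rpow_zero, one_mul, ← abs_of_nonpos h] at h3
  rw [Real.div_rpow ht zero_le_two, Real.rpow_sub two_pos, Real.rpow_neg zero_le_two]
  calc (2 ^ p)⁻¹ / 2 ^ |α| * (t ^ p / y ^ α) = t ^ p / 2 ^ p / (2 ^ |α| * y ^ α) := by
        field_simp
    _ ≤ t ^ p / 2 ^ p / x ^ α := by gcongr

theorem rpow_mul_log_rpow_neg_eq {p α t : ℝ} (hp : 0 < p) (ht : 0 ≤ t) :
    t ^ (p + 1) * Real.log (Real.exp 1 + t) ^ (-α) = t * a p α t := by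
  have hL := one_le_log_exp_one_add ht
  rw [a, Real.rpow_neg (by linarith), Real.rpow_add_one' ht (by linarith)]
  ring

/-- For p > 0 and α ≤ p, there exist constants C₁', C₂' > 0 depending
only on p and α such that C₁' t^{p+1}(log(e+t))^{-α} ≤ A(t) ≤ C₂' t^{p+1}(log(e+t))^{-α}
for all t ≥ 0; moreover there exist d₁, d₂ > 0 with d₁ t a(t) ≤ A(t) ≤ d₂ t a(t)
for all t ≥ 0. -/
theorem A_bounds (p α : ℝ) (hp : 0 < p) (hα : α ≤ p) :
    (∃ C₁' C₂' : ℝ, 0 < C₁' ∧ 0 < C₂' ∧ ∀ t : ℝ, 0 ≤ t →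
      C₁' * t ^ (p + 1) * Real.log (Real.exp 1 + t) ^ (-α) ≤ A p α t ∧
      A p α t ≤ C₂' * t ^ (p + 1) * Real.log (Real.exp 1 + t) ^ (-α)) ∧
    (∃ d₁ d₂ : ℝ, 0 < d₁ ∧ 0 < d₂ ∧ ∀ t : ℝ, 0 ≤ t →
      d₁ * (t * a p α t) ≤ A p α t ∧ A p α t ≤ d₂ * (t * a p α t)) := by
  have hc : (0 : ℝ) < 2 ^ (-p - |α|) / 2 := by positivity
  have bounds : ∀ t : ℝ, 0 ≤ t → 2 ^ (-p - |α|) / 2 * (t * a p α t) ≤ A p α t ∧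
      A p α t ≤ 1 * (t * a p α t) := by
    intro t ht
    refine ⟨le_trans ?_ (half_mul_a_half_le_A hp hα ht), ?_⟩
    · linarith [mul_le_mul_of_nonneg_left (mul_a_le_a_half (p := p) (α := α) ht) (by linarith : 0 ≤ t / 2)]
    · rw [one_mul]
      exact A_le_mul_a hp hα ht
  refine ⟨⟨_, 1, hc, one_pos, fun t ht => ?_⟩, _, 1, hc, one_pos, bounds⟩
  rw [mul_assoc, mul_assoc, rpow_mul_log_rpow_neg_eq hp ht]
  exact bounds t ht
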